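/- Assume the block setup. Let i ∈ W, and let σ be an alignment of L_1 into Y_i under which Z_i is 1/2-aligned with the segment S_{i+1}⋯S_n S_i S_{i_r}⋯S_{i_s} of Y_i, and suppose there is no j ∈ W with j > i such that σ maps some position of Z_j to a position inside the block S_j lying within the segment S_{i+1}⋯S_n of Y_i. Let W^{>i} = {t ∈ W : t > i}. Then |{t ∈ W^{>i} : v_t ∈ N_>(v_i)}| + (β/(2α))·|{t ∈ W^{>i} : v_t ∉ N_>(v_i)}| ≤ 2(n−i)+1. -/

import Mathlib

open scoped Classical

/-- The maximum length of a common subsequence of two strings (lists). -/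
noncomputable def lcsLen {α : Type*} (S T : List α) : ℕ :=
  sSup {k | ∃ Z : List α, Z.Sublist S ∧ Z.Sublist T ∧ Z.length = k}

/-- The Jiang–Li string `X_i`. -/
def JLX {n : ℕ} (G : SimpleGraph (Fin n)) [DecidableRel G.Adj] (i : Fin n) : List (Fin n) :=
  (List.finRange n).filter (fun j => decide (j ≠ i)) ++ [i] ++
    (List.finRange n).filter (fun j => decide (G.Adj i j ∧ i < j))

/-- The Jiang–Li string `X'_i`. -/
def JLX' {n : ℕ} (G : SimpleGraph (Fin n)) [DecidableRel G.Adj] (i : Fin n) : List (Fin n) :=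
  (List.finRange n).filter (fun j => decide (G.Adj i j ∧ j < i)) ++ [i] ++
    (List.finRange n).filter (fun j => decide (j ≠ i))

/-- The number of neighbours of `v_i` with smaller index, i.e. `|N_<(v_i)|`. -/
def numNbrLT {n : ℕ} (G : SimpleGraph (Fin n)) [DecidableRel G.Adj] (i : Fin n) : ℕ :=
  ((List.finRange n).filter (fun j => decide (G.Adj i j ∧ j < i))).length

/-- The block string `Y_i`. -/
def JLY {n : ℕ} {A : Type*} (G : SimpleGraph (Fin n)) [DecidableRel G.Adj]
    (S : Fin n → List A) (i : Fin n) : List A :=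
  ((JLX G i).map S).flatten

/-- The block string `Y'_i`. -/
def JLY' {n : ℕ} {A : Type*} (G : SimpleGraph (Fin n)) [DecidableRel G.Adj]
    (S : Fin n → List A) (i : Fin n) : List A :=
  ((JLX' G i).map S).flatten

/-- The string `L₁ = Z_1 Z_2 ⋯ Z_n`. -/
def L1str {n : ℕ} {A : Type*} (Z : Fin n → List A) : List A :=
  ((List.finRange n).map Z).flatten

/-- The position in `L₁` at which the piece `Z_t` starts. -/
def blockOffset {n : ℕ} {A : Type*} (Z : Fin n → List A) (t : Fin n) : ℕ :=
  ∑ s ∈ Finset.univ.filter (fun s : Fin n => s < t), (Z s).length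

/-- An alignment of `L` into `Y`: a strictly increasing map on positions of `L`
under which corresponding symbols agree. -/
def IsAlignment {A : Type*} (L Y : List A) (σ : ℕ → ℕ) : Prop :=
  (∀ p q : ℕ, p < q → q < L.length → σ p < σ q) ∧
  (∀ p : ℕ, p < L.length → σ p < Y.length) ∧
  (∀ (p : ℕ) (hp : p < L.length) (hq : σ p < Y.length), L.get ⟨p, hp⟩ = Y.get ⟨σ p, hq⟩)

/-- `Z_t` is `1/2`-aligned (under `σ`) with the segment of `Y` occupying the
positions `[lo, hi)`: all positions of the first `⌈|Z_t|/2⌉` symbols of `Z_t`, or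
all positions of the last `⌈|Z_t|/2⌉` symbols of `Z_t`, are mapped into `[lo, hi)`. -/
def HalfAligned {n : ℕ} {A : Type*} (σ : ℕ → ℕ) (Z : Fin n → List A) (t : Fin n)
    (lo hi : ℕ) : Prop :=
  (∀ p : ℕ, blockOffset Z t ≤ p → p < blockOffset Z t + ((Z t).length + 1) / 2 →
      lo ≤ σ p ∧ σ p < hi) ∨
  (∀ p : ℕ, blockOffset Z t + (Z t).length - ((Z t).length + 1) / 2 ≤ p →
      p < blockOffset Z t + (Z t).length → lo ≤ σ p ∧ σ p < hi)

/-- `σ` maps some position of `Z_j` into the positions `[lo, hi)` of the target. -/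
def HitsSegment {n : ℕ} {A : Type*} (σ : ℕ → ℕ) (Z : Fin n → List A) (j : Fin n)
    (lo hi : ℕ) : Prop :=
  ∃ p : ℕ, blockOffset Z j ≤ p ∧ p < blockOffset Z j + (Z j).length ∧
    lo ≤ σ p ∧ σ p < hi

/-- `C[i,j] = {t ∈ W : i ≤ t ≤ j}` where `W = {t : Z_t ≠ ε}`. -/
noncomputable def Cset {n : ℕ} {A : Type*} (Z : Fin n → List A) (i j : Fin n) :
    Finset (Fin n) :=
  Finset.univ.filter (fun t => Z t ≠ [] ∧ i ≤ t ∧ t ≤ j)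

theorem aux_get {A : Type*} (l : List (List A)) (k : ℕ) (hk : k < l.length) (q : ℕ)
    (hq : q < l[k].length) :
    l.flatten[((l.map List.length).take k).sum + q]? = l[k][q]? := by
  induction l generalizing k with
  | nil => simp at hk
  | cons a l ih =>
    cases k with
    | zero =>
      simp at hq ⊢
      rw [List.getElem?_append_left hq]
    | succ k =>
      simp at hk hq ⊢
      rw [List.getElem?_append_right (by omega)]
      have := ih k hk hq
      rw [show a.length + (List.take k (List.map List.length l)).sum + q - a.length
        = (List.take k (List.map List.length l)).sum + q by omega, this]

theorem aux_sublist {A : Type*} {k : ℕ} (w : Fin k → A) (T : List A) (f : Fin k → ℕ)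
    (hf : StrictMono f) (h : ∀ x, T[f x]? = some (w x)) : (List.ofFn w).Sublist T := by
  have hlt : ∀ x, f x < T.length := fun x => by
    obtain ⟨h1, _⟩ := List.getElem?_eq_some_iff.1 (h x)
    exact h1
  rw [List.sublist_iff_exists_fin_orderEmbedding_get_eq]
  refine ⟨OrderEmbedding.ofStrictMono
    (fun x => ⟨f (Fin.cast (by simp) x), hlt _⟩) ?_, ?_⟩
  · intro x y hxy
    exact hf (by simpa using hxy)
  · intro x
    obtain ⟨_, h2⟩ := List.getElem?_eq_some_iff.1 (h (Fin.cast (by simp) x))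
    rw [List.get_ofFn]
    exact h2.symm

theorem aux_lcs {A : Type*} (S T U : List A) (h1 : U.Sublist S) (h2 : U.Sublist T) :
    U.length ≤ lcsLen S T := by
  refine le_csSup ⟨S.length, ?_⟩ ⟨U, h1, h2, rfl⟩
  rintro k ⟨V, hV, _, rfl⟩
  exact hV.length_le

theorem aux_off {n : ℕ} {A : Type*} (Z : Fin n → List A) (t : Fin n) :
    blockOffset Z t = ((((List.finRange n).map Z).map List.length).take t.val).sum := by
  rw [List.map_map, ← List.ofFn_eq_map, List.sum_take_ofFn]
  rfl

theorem aux_L {n : ℕ} {A : Type*} (Z : Fin n → List A) (t : Fin n) (q : ℕ)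
    (hq : q < (Z t).length) : (L1str Z)[blockOffset Z t + q]? = (Z t)[q]? := by
  rw [aux_off]
  have := aux_get ((List.finRange n).map Z) t.val (by simp) q (by simpa using hq)
  rw [L1str, this]
  simp

theorem aux_lt {n : ℕ} {A : Type*} (Z : Fin n → List A) (s t : Fin n) (h : s < t) :
    blockOffset Z s + (Z s).length ≤ blockOffset Z t := by
  unfold blockOffset
  rw [add_comm, ← Finset.sum_insert (f := fun x => (Z x).length) (a := s) (by simp)]
  apply Finset.sum_le_sum_of_subset
  intro x
  simp
  rintro (rfl | hx)
  · exact h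
  · exact hx.trans h

theorem aux_Ylen {I A : Type*} {m : ℕ} (S : I → List A) (hS : ∀ j, (S j).length = m)
    (X : List I) : ((X.map S).flatten).length = X.length * m := by
  induction X with
  | nil => simp
  | cons a l ih => simp at ih; simp [hS, ih]; ring

theorem aux_Y {I A : Type*} {m : ℕ} (S : I → List A) (hS : ∀ j, (S j).length = m)
    (X : List I) (b r : ℕ) (c : I) (hb : X[b]? = some c) (hr : r < m) :
    ((X.map S).flatten)[b * m + r]? = (S c)[r]? := by
  obtain ⟨hb1, hb2⟩ := List.getElem?_eq_some_iff.1 hb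
  have := aux_get (X.map S) b (by simpa using hb1) r (by simp [hS, hr])
  have h2 : (((X.map S).map List.length).take b).sum = b * m := by
    have : ((X.map S).map List.length) = List.replicate X.length m := by
      apply List.ext_getElem <;> simp [hS]
    rw [this, List.take_replicate, List.sum_replicate, min_eq_left hb1.le, smul_eq_mul]
  rw [h2] at this
  rw [this]
  simp [hb2]

theorem aux_X1 {n : ℕ} (i : Fin n) :
    (List.finRange n).filter (fun j => decide (j ≠ i)) = (List.finRange n).eraseIdx i.val := by
  have h := List.Nodup.erase_getElem (List.nodup_finRange n) i.val (by simp)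
  rw [← h, List.Nodup.erase_eq_filter (List.nodup_finRange n)]
  apply List.filter_congr
  intro x _
  simp [bne]
  rw [Bool.eq_iff_iff]
  simp

theorem aux_Xlen {n : ℕ} (G : SimpleGraph (Fin n)) [DecidableRel G.Adj] (i : Fin n) :
    (JLX G i).length + i.val ≤ n + (n - 1) := by
  unfold JLX
  rw [aux_X1]
  have h : ((List.finRange n).filter (fun j => decide (G.Adj i j ∧ i < j))).length
      ≤ n - 1 - i.val := by
    rw [← List.toFinset_card_of_nodup ((List.nodup_finRange n).filter _), ← Fin.card_Ioi]
    apply Finset.card_le_card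
    intro x
    simp
  have := i.isLt
  simp [List.length_eraseIdx] at h ⊢
  omega

theorem aux_Xlab {n : ℕ} (G : SimpleGraph (Fin n)) [DecidableRel G.Adj] (i t : Fin n) (b : ℕ)
    (hb : (JLX G i)[b]? = some t) (hib : i.val ≤ b) (hit : i < t) :
    b = t.val - 1 ∨ G.Adj i t := by
  unfold JLX at hb
  rw [aux_X1, List.append_assoc] at hb
  rw [List.getElem?_append] at hb
  split_ifs at hb with h1
  · left
    rw [List.getElem?_eraseIdx, if_neg (by omega)] at hb
    obtain ⟨h3, h4⟩ := List.getElem?_eq_some_iff.1 hb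
    have := congrArg Fin.val h4
    simp at this
    omega
  · right
    have := List.mem_of_getElem? hb
    simp at this
    rcases this with h | h
    · exact absurd h hit.ne'
    · exact h.1

/-- A piece avoiding blocks with its own label spans many blocks. -/
theorem aux_span {n m : ℕ} {A : Type*} (α : ℝ) (S Z : Fin n → List A)
    (hSlen : ∀ j, (S j).length = m) (hm : 0 < m) (X : List (Fin n))
    (hLCS : ∀ i j : Fin n, i ≠ j → ((lcsLen (S i) (S j) : ℕ) : ℝ) ≤ α * m)
    (hsub : ∀ t, (Z t).Sublist (S t)) (σ : ℕ → ℕ)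
    (hal : IsAlignment (L1str Z) ((X.map S).flatten) σ) (t : Fin n) (lo hi : ℕ)
    (hα0 : 0 < α) (hlohi : lo ≤ hi)
    (hrange : ∀ p, blockOffset Z t ≤ p → p < blockOffset Z t + (Z t).length →
      lo ≤ σ p / m ∧ σ p / m ≤ hi ∧ X[σ p / m]? ≠ some t) :
    ((Z t).length : ℝ) ≤ ((hi : ℝ) - lo + 1) * (α * m) := by
  obtain ⟨hmono, hrng, hget⟩ := hal
  set o := blockOffset Z t with ho
  have hL : ∀ p, o ≤ p → p < o + (Z t).length → ∃ hp : p < (L1str Z).length,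
      (Z t)[p - o]? = some ((L1str Z)[p]) := by
    intro p h1 h2
    have := aux_L Z t (p - o) (by omega)
    rw [← ho, show o + (p - o) = p by omega, List.getElem?_eq_getElem (by omega : p - o < (Z t).length)] at this
    obtain ⟨h3, h4⟩ := List.getElem?_eq_some_iff.1 this
    exact ⟨h3, by rw [h4, List.getElem?_eq_getElem]⟩
  have hcard : ∀ b ∈ Finset.Icc lo hi,
      ((((Finset.Ico o (o + (Z t).length)).filter (fun p => σ p / m = b)).card : ℕ) : ℝ)
        ≤ α * m := by
    intro b _
    set P := (Finset.Ico o (o + (Z t).length)).filter (fun p => σ p / m = b) with hP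
    have hmem : ∀ x : Fin P.card, (o ≤ P.orderEmbOfFin rfl x ∧
        P.orderEmbOfFin rfl x < o + (Z t).length) ∧ σ (P.orderEmbOfFin rfl x) / m = b := by
      intro x
      have := P.orderEmbOfFin_mem rfl x
      have h := Finset.mem_filter.1 this
      exact ⟨Finset.mem_Ico.1 h.1, h.2⟩
    set e := P.orderEmbOfFin rfl with he
    by_cases hPe : P.card = 0
    · rw [hPe]
      simp only [Nat.cast_zero]
      positivity
    have x0 : Fin P.card := ⟨0, Nat.pos_of_ne_zero hPe⟩
    have hbX : b < X.length := by
      obtain ⟨⟨h1, h2⟩, h3⟩ := hmem x0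
      obtain ⟨hp, _⟩ := hL _ h1 h2
      have h4 := hrng _ hp
      rw [aux_Ylen S hSlen] at h4
      rw [← h3]
      exact Nat.div_lt_of_lt_mul (by rwa [mul_comm])
    have hne : X[b] ≠ t := by
      obtain ⟨⟨h1, h2⟩, h3⟩ := hmem x0
      have := (hrange _ h1 h2).2.2
      rw [h3, List.getElem?_eq_getElem hbX] at this
      exact fun h => this (by rw [h])
    refine le_trans ?_ (hLCS t X[b] hne.symm)
    have hlen : ∀ x, e x < (L1str Z).length := fun x => (hL _ (hmem x).1.1 (hmem x).1.2).1
    have := aux_lcs (S t) (S X[b]) (List.ofFn (fun x : Fin P.card => (L1str Z)[e x]'(hlen x)))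
      ?_ ?_
    · rw [List.length_ofFn] at this
      exact_mod_cast this
    · refine List.Sublist.trans ?_ (hsub t)
      apply aux_sublist _ _ (fun x => e x - o)
      · intro x y hxy
        have h1 := e.strictMono hxy
        have h2 := (hmem x).1.1
        show e x - o < e y - o
        omega
      · intro x
        exact (hL _ (hmem x).1.1 (hmem x).1.2).2
    · apply aux_sublist _ _ (fun x => σ (e x) % m)
      · intro x y hxy
        have h1 := hmono _ _ (e.strictMono hxy) (hlen y)
        have h2 := (hmem x).2
        have h3 := (hmem y).2
        have h4 := Nat.div_add_mod (σ (e x)) m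
        have h5 := Nat.div_add_mod (σ (e y)) m
        rw [h2] at h4
        rw [h3] at h5
        show σ (e x) % m < σ (e y) % m
        omega
      · intro x
        have h1 := hget (e x) (hlen x) (hrng _ (hlen x))
        have h2 := aux_Y S hSlen X b (σ (e x) % m) X[b] (List.getElem?_eq_getElem hbX)
          (Nat.mod_lt _ hm)
        have h3 : b * m + σ (e x) % m = σ (e x) := by
          have := Nat.div_add_mod (σ (e x)) m
          rw [(hmem x).2] at this
          rw [mul_comm]; exact this
        rw [h3] at h2
        show (S X[b])[σ (e x) % m]? = _
        rw [← h2, List.getElem?_eq_getElem (hrng _ (hlen x))]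
        simpa using h1.symm
  have hsum : (Finset.Ico o (o + (Z t).length)).card = ∑ b ∈ Finset.Icc lo hi,
      ((Finset.Ico o (o + (Z t).length)).filter (fun p => σ p / m = b)).card := by
    apply Finset.card_eq_sum_card_fiberwise
    intro p hp
    simp at hp
    have := hrange p hp.1 hp.2
    simp [this.1, this.2.1]
  have h2 : ((Z t).length : ℝ) ≤ ∑ b ∈ Finset.Icc lo hi, (α * m) := by
    have h3 : (Z t).length = (Finset.Ico o (o + (Z t).length)).card := by simp
    rw [h3, hsum]
    push_cast
    exact Finset.sum_le_sum hcard
  rw [Finset.sum_const, Nat.card_Icc, nsmul_eq_mul] at h2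
  convert h2 using 2
  rw [Nat.cast_sub (by omega)]
  push_cast
  ring

/-- Claim 3 (dense case, forward): if `Z_i` is 1/2-aligned with the segment
`S_{i+1}⋯S_n S_i S_{N_>(v_i)}` of `Y_i` and no `j ∈ W`, `j > i`, has a position of
`Z_j` mapped into the block `S_j` inside `S_{i+1}⋯S_n` (that block occupies positions
`[(j−1)m, jm)` of `Y_i`), then
`|W^{>i} ∩ N_>(v_i)| + (β/2α)·|W^{>i} \ N_>(v_i)| ≤ 2(n−i)+1`
(with `i` 1-indexed, i.e. `i = i.val + 1`). -/
theorem stmt10 {n m : ℕ} {A : Type*} (α β : ℝ)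
    (hα0 : 0 < α) (hα : α < 1 / 8) (hβ : β = Real.sqrt (8 * α))
    (G : SimpleGraph (Fin n)) [DecidableRel G.Adj]
    (S Z : Fin n → List A) (hSlen : ∀ j, (S j).length = m)
    (hLCS : ∀ i j : Fin n, i ≠ j → ((lcsLen (S i) (S j) : ℕ) : ℝ) ≤ α * m)
    (hsub : ∀ t, (Z t).Sublist (S t))
    (hZlen : ∀ t, Z t ≠ [] → β * m ≤ ((Z t).length : ℝ))
    (i : Fin n) (hi : Z i ≠ [])
    (σ : ℕ → ℕ) (hal : IsAlignment (L1str Z) (JLY G S i) σ)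
    (hhalf : HalfAligned σ Z i (i.val * m) (JLY G S i).length)
    (hno : ¬ ∃ j : Fin n, i < j ∧ Z j ≠ [] ∧
        HitsSegment σ Z j ((j.val - 1) * m) (j.val * m)) :
    ((Finset.univ.filter (fun t : Fin n => Z t ≠ [] ∧ i < t ∧ G.Adj i t)).card : ℝ)
      + (β / (2 * α)) *
        ((Finset.univ.filter (fun t : Fin n => Z t ≠ [] ∧ i < t ∧ ¬ G.Adj i t)).card : ℝ)
      ≤ 2 * ((n : ℝ) - (i.val + 1)) + 1 := by
  have hm : 0 < m := by
    rw [← hSlen i]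
    exact lt_of_lt_of_le (List.length_pos_iff.2 hi) (hsub i).length_le
  have hmR : (0 : ℝ) < m := by exact_mod_cast hm
  have hal' := hal
  obtain ⟨hmono, hrng, -⟩ := hal
  set X := JLX G i with hX
  have hYlen : (JLY G S i).length = X.length * m := aux_Ylen S hSlen X
  have hLlen : ∀ t p, blockOffset Z t ≤ p → p < blockOffset Z t + (Z t).length → p < (L1str Z).length := by
    intro t p hp0 hp
    have := aux_L Z t ((Z t).length - 1) (by omega)
    rw [List.getElem?_eq_getElem (by omega : (Z t).length - 1 < (Z t).length)] at this
    obtain ⟨h3, _⟩ := List.getElem?_eq_some_iff.1 this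
    omega
  have hbmono : ∀ p q, p ≤ q → q < (L1str Z).length → σ p / m ≤ σ q / m := by
    intro p q hpq hq
    apply Nat.div_le_div_right
    rcases hpq.eq_or_lt with rfl | h
    · exact le_rfl
    · exact (hmono p q h hq).le
  have hbX : ∀ p, p < (L1str Z).length → σ p / m < X.length := by
    intro p hp
    have := hrng p hp
    rw [hYlen] at this
    exact Nat.div_lt_of_lt_mul (by rwa [mul_comm])
  have hZi := List.length_pos_iff.2 hi
  -- pieces after `Z_i` land in the segment
  have hseg : ∀ t, i < t → ∀ p, blockOffset Z t ≤ p → p < blockOffset Z t + (Z t).length →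
      i.val ≤ σ p / m := by
    intro t hit p h1 h2
    have h3 := aux_lt Z i t hit
    have hex : ∃ q, q ≤ p ∧ i.val * m ≤ σ q := by
      rcases hhalf with h | h
      · exact ⟨blockOffset Z i, by omega, (h _ le_rfl (by omega)).1⟩
      · exact ⟨blockOffset Z i + (Z i).length - 1, by omega, (h _ (by omega) (by omega)).1⟩
    obtain ⟨q, hq1, hq2⟩ := hex
    refine le_trans ?_ (hbmono q p hq1 (hLlen t p h1 h2))
    exact (Nat.le_div_iff_mul_le hm).2 hq2
  let good : Fin n → Prop := fun t => ∃ p, blockOffset Z t ≤ p ∧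
    p < blockOffset Z t + (Z t).length ∧ X[σ p / m]? = some t
  have hgood : ∀ t, i < t → Z t ≠ [] → good t → G.Adj i t := by
    rintro t hit ht ⟨p, h1, h2, h3⟩
    rcases aux_Xlab G i t _ h3 (hseg t hit p h1 h2) hit with h | h
    · exfalso
      refine hno ⟨t, hit, ht, p, h1, h2, ?_, ?_⟩
      · rw [← h]; exact Nat.div_mul_le_self _ _
      · have : t.val = σ p / m + 1 := by
          have : i.val < t.val := hit
          omega
        rw [this]
        exact Nat.lt_mul_of_div_lt (Nat.lt_succ_self _) hm
    · exact h
  let lo : Fin n → ℕ := fun t => σ (blockOffset Z t) / m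
  let hiB : Fin n → ℕ := fun t => σ (blockOffset Z t + (Z t).length - 1) / m
  let F : Fin n → Finset ℕ := fun t =>
    if h : good t then {σ h.choose / m} else Finset.Ioo (lo t) (hiB t)
  have hFg : ∀ t, good t → ∃ p, blockOffset Z t ≤ p ∧
      p < blockOffset Z t + (Z t).length ∧ X[σ p / m]? = some t ∧ F t = {σ p / m} := by
    intro t h
    exact ⟨h.choose, h.choose_spec.1, h.choose_spec.2.1, h.choose_spec.2.2, by simp [F, h]⟩
  have hFb : ∀ t, ¬ good t → F t = Finset.Ioo (lo t) (hiB t) := by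
    intro t h
    simp [F, h]
  set W := Finset.univ.filter (fun t : Fin n => Z t ≠ [] ∧ i < t) with hW
  have hdisj0 : ∀ s t, s < t → Z s ≠ [] → Z t ≠ [] → Disjoint (F s) (F t) := by
    intro s t hst hs ht
    have h0 := aux_lt Z s t hst
    have hs' := List.length_pos_iff.2 hs
    have ht' := List.length_pos_iff.2 ht
    rw [Finset.disjoint_left]
    intro x hxs hxt
    by_cases gs : good s <;> by_cases gt : good t
    · obtain ⟨p, p1, p2, p3, p4⟩ := hFg s gs
      obtain ⟨q, q1, q2, q3, q4⟩ := hFg t gt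
      rw [p4, Finset.mem_singleton] at hxs
      rw [q4, Finset.mem_singleton] at hxt
      rw [← hxs] at p3
      rw [← hxt, p3] at q3
      exact hst.ne (Option.some.inj q3)
    · obtain ⟨p, p1, p2, p3, p4⟩ := hFg s gs
      rw [p4, Finset.mem_singleton] at hxs
      rw [hFb t gt, Finset.mem_Ioo] at hxt
      have := hbmono p (blockOffset Z t) (by omega) (hLlen t _ (by omega) (by omega))
      have h5 := hxt.1
      simp only [lo] at h5
      omega
    · obtain ⟨q, q1, q2, q3, q4⟩ := hFg t gt
      rw [q4, Finset.mem_singleton] at hxt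
      rw [hFb s gs, Finset.mem_Ioo] at hxs
      have := hbmono (blockOffset Z s + (Z s).length - 1) q (by omega) (hLlen t _ (by omega) (by omega))
      have h5 := hxs.2
      simp only [hiB] at h5
      omega
    · rw [hFb s gs, Finset.mem_Ioo] at hxs
      rw [hFb t gt, Finset.mem_Ioo] at hxt
      have := hbmono (blockOffset Z s + (Z s).length - 1) (blockOffset Z t) (by omega)
        (hLlen t _ (by omega) (by omega))
      have h5 := hxs.2
      have h6 := hxt.1
      simp only [hiB] at h5
      simp only [lo] at h6
      omega
  have hdisj : (W : Set (Fin n)).PairwiseDisjoint F := by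
    intro s hs t ht hst
    simp [hW] at hs ht
    rcases lt_or_gt_of_ne hst with h | h
    · exact hdisj0 s t h hs.1 ht.1
    · exact (hdisj0 t s h ht.1 hs.1).symm
  have hsubF : W.biUnion F ⊆ Finset.Ico i.val X.length := by
    intro x hx
    rw [Finset.mem_biUnion] at hx
    obtain ⟨t, ht, hx⟩ := hx
    simp only [hW, Finset.mem_filter, Finset.mem_univ, true_and] at ht
    have ht' := List.length_pos_iff.2 ht.1
    rw [Finset.mem_Ico]
    by_cases g : good t
    · obtain ⟨p, p1, p2, p3, p4⟩ := hFg t g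
      rw [p4, Finset.mem_singleton] at hx
      rw [hx]
      exact ⟨hseg t ht.2 p p1 p2, hbX p (hLlen t p p1 p2)⟩
    · rw [hFb t g, Finset.mem_Ioo] at hx
      have h1 : i.val ≤ lo t := hseg t ht.2 _ le_rfl (by omega)
      have h2 : hiB t < X.length := hbX _ (hLlen t _ (by omega) (by omega))
      omega
  have hcount : ∑ t ∈ W, (F t).card + i.val ≤ X.length := by
    rw [← Finset.card_biUnion hdisj]
    have h1 := Finset.card_le_card hsubF
    rw [Nat.card_Ico] at h1
    have h2 : i.val ≤ X.length := by
      have h3 : n - 1 + 1 ≤ X.length := by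
        rw [hX, JLX, aux_X1]
        simp [List.length_eraseIdx]
      have := i.isLt
      omega
    omega
  have hβ2 : β ^ 2 = 8 * α := by rw [hβ]; exact Real.sq_sqrt (by linarith)
  have hβ0 : 0 < β := by rw [hβ]; exact Real.sqrt_pos.2 (by linarith)
  have hβα : 4 * α ≤ β := by
    by_contra hc
    push Not at hc
    nlinarith
  have hratio : 2 ≤ β / (2 * α) := by
    rw [le_div_iff₀ (by linarith)]; linarith
  have hbad : ∀ t ∈ W, ¬ good t → β / (2 * α) ≤ ((F t).card : ℝ) := by
    intro t ht g
    simp only [hW, Finset.mem_filter, Finset.mem_univ, true_and] at ht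
    have ht' := List.length_pos_iff.2 ht.1
    have h1 := aux_span α S Z hSlen hm X hLCS hsub σ hal' t (lo t) (hiB t) hα0
      (hbmono _ _ (by omega) (hLlen t _ (by omega) (by omega)))
      (fun p p1 p2 => ⟨hbmono _ _ p1 (hLlen t p p1 p2),
        hbmono _ _ (by omega) (hLlen t _ (by omega) (by omega)), fun h => g ⟨p, p1, p2, h⟩⟩)
    have h2 := (hZlen t ht.1).trans h1
    have h3 : β ≤ ((hiB t : ℝ) - lo t + 1) * α := by
      rw [← mul_assoc] at h2
      exact le_of_mul_le_mul_right h2 hmR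
    have h4 : 2 * (β / (2 * α)) ≤ (hiB t : ℝ) - lo t + 1 := by
      rw [show 2 * (β / (2 * α)) = β / α by field_simp]
      rwa [div_le_iff₀ hα0]
    have h5 : (hiB t : ℝ) - lo t - 1 ≤ ((F t).card : ℝ) := by
      rw [hFb t g, Nat.card_Ioo]
      have : hiB t ≤ (hiB t - lo t - 1) + lo t + 1 := by omega
      have h6 : (hiB t : ℝ) ≤ ((hiB t - lo t - 1 : ℕ) : ℝ) + lo t + 1 := by exact_mod_cast this
      linarith
    linarith
  have hterm : ∀ t ∈ W, (if G.Adj i t then (1 : ℝ) else β / (2 * α)) ≤ ((F t).card : ℝ) := by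
    intro t ht
    by_cases g : good t
    · have ht2 := ht
      simp only [hW, Finset.mem_filter, Finset.mem_univ, true_and] at ht2
      rw [if_pos (hgood t ht2.2 ht2.1 g)]
      obtain ⟨p, _, _, _, p4⟩ := hFg t g
      rw [p4]; simp
    · have := hbad t ht g
      split_ifs
      · linarith
      · exact this
  have hfin := Finset.sum_le_sum hterm
  rw [Finset.sum_ite, Finset.sum_const, Finset.sum_const, nsmul_eq_mul, nsmul_eq_mul, hW,
    Finset.filter_filter, Finset.filter_filter] at hfin
  simp only [and_assoc] at hfin
  have hXl := aux_Xlen G i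
  rw [← hX] at hXl
  have hn : 1 ≤ n := by have := i.isLt; omega
  have hall : ∑ t ∈ W, (F t).card + i.val + i.val + 1 ≤ 2 * n := by omega
  have hallR : (∑ t ∈ W, ((F t).card : ℝ)) + i.val + i.val + 1 ≤ 2 * n := by
    exact_mod_cast hall
  rw [hW] at hallR
  rw [mul_comm (β / (2 * α))]
  linarith
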